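/- arXiv:2604.24423 — 2 statements merged into one kernel-verified Lean document; each statement's English description precedes it below -/
import Mathlib

section
/- Let m ≥ 3 and r := min{rank A, rank B}. For every real m×m matrix C: (i) if r = 3 and the column space of C is contained in the column space of A and the column space of Cᵀ is contained in the column space of B, then γ_{C_qm}(C) = s'_1 + s'_2 + sgn(det(A⁺ C (Bᵀ)⁺))·s'_3, where s'_1 ≥ s'_2 ≥ s'_3 ≥ 0 are the singular values of A⁺ C (Bᵀ)⁺; (ii) if r = 3 and one of these range conditions fails, then γ_{C_qm}(C) = +∞; (iii) if r ≤ 2, then γ_{C_qm}(C) = γ_{C_max}(C). -/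
open Matrix Kronecker
open scoped ENNReal ComplexOrder

namespace BellCorr

/-- The three Pauli matrices. -/
noncomputable def pauli (k : Fin 3) : Matrix (Fin 2) (Fin 2) ℂ :=
  if k = 0 then !![0, 1; 1, 0]
  else if k = 1 then !![0, -Complex.I; Complex.I, 0]
  else !![1, 0; 0, -1]

/-- The observable `Â_i = ∑ k A i k • σ_k` associated with row `i` of `A`. -/
noncomputable def obs {m : ℕ} (A : Matrix (Fin m) (Fin 3) ℝ) (i : Fin m) :
    Matrix (Fin 2) (Fin 2) ℂ :=
  ∑ k : Fin 3, (A i k : ℂ) • pauli k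

/-- The correlation map `Φ_AB`, sending a 4×4 complex matrix to the real m×m matrix
with entries `Tr[ρ (Â_i ⊗ B̂_j)]`. -/
noncomputable def corr {m : ℕ} (A B : Matrix (Fin m) (Fin 3) ℝ)
    (ρ : Matrix (Fin 2 × Fin 2) (Fin 2 × Fin 2) ℂ) : Matrix (Fin m) (Fin m) ℝ :=
  Matrix.of fun i j => ((ρ * (obs A i ⊗ₖ obs B j)).trace).re

/-- Separable states: convex hull of products of 2×2 PSD trace-one matrices. -/
noncomputable def Ssep : Set (Matrix (Fin 2 × Fin 2) (Fin 2 × Fin 2) ℂ) :=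
  convexHull ℝ {ρ | ∃ ρA ρB : Matrix (Fin 2) (Fin 2) ℂ,
    ρA.PosSemidef ∧ ρA.trace = 1 ∧ ρB.PosSemidef ∧ ρB.trace = 1 ∧ ρ = ρA ⊗ₖ ρB}

/-- Quantum states: 4×4 PSD matrices of trace one. -/
def Sqm : Set (Matrix (Fin 2 × Fin 2) (Fin 2 × Fin 2) ℂ) :=
  {ρ | ρ.PosSemidef ∧ ρ.trace = 1}

/-- Maximal-tensor-product states: self-adjoint trace-one matrices pairing
nonnegatively with every product of PSD matrices. -/
def Smax : Set (Matrix (Fin 2 × Fin 2) (Fin 2 × Fin 2) ℂ) :=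
  {ρ | ρ.IsHermitian ∧ ρ.trace = 1 ∧
    ∀ P Q : Matrix (Fin 2) (Fin 2) ℂ, P.PosSemidef → Q.PosSemidef →
      0 ≤ ((ρ * (P ⊗ₖ Q)).trace).re}

noncomputable def Csep {m : ℕ} (A B : Matrix (Fin m) (Fin 3) ℝ) :
    Set (Matrix (Fin m) (Fin m) ℝ) := corr A B '' Ssep

noncomputable def Cqm {m : ℕ} (A B : Matrix (Fin m) (Fin 3) ℝ) :
    Set (Matrix (Fin m) (Fin m) ℝ) := corr A B '' Sqm

noncomputable def Cmax {m : ℕ} (A B : Matrix (Fin m) (Fin 3) ℝ) :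
    Set (Matrix (Fin m) (Fin m) ℝ) := corr A B '' Smax

/-- Support function `φ_K(Z) = sup_{C ∈ K} Tr[Zᵀ C]`. -/
noncomputable def suppFn {m : ℕ} (K : Set (Matrix (Fin m) (Fin m) ℝ))
    (Z : Matrix (Fin m) (Fin m) ℝ) : ℝ :=
  sSup ((fun C => (Zᵀ * C).trace) '' K)

/-- Gauge function `γ_K(C) = inf {t > 0 : C/t ∈ K}`, with value `+∞` if no such `t` exists. -/
noncomputable def gaugeFn {m : ℕ} (K : Set (Matrix (Fin m) (Fin m) ℝ))
    (C : Matrix (Fin m) (Fin m) ℝ) : ℝ≥0∞ :=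
  ⨅ (t : ℝ) (_ : 0 < t ∧ t⁻¹ • C ∈ K), ENNReal.ofReal t

/-- `XᵀX` is Hermitian for a real matrix `X`. -/
lemma isHermitian_tr_mul_self (X : Matrix (Fin 3) (Fin 3) ℝ) : (Xᵀ * X).IsHermitian := by
  simpa [Matrix.conjTranspose_eq_transpose_of_trivial] using
    Matrix.isHermitian_conjTranspose_mul_self X

/-- The singular values of a real 3×3 matrix, in decreasing order:
`sval X 0 ≥ sval X 1 ≥ sval X 2 ≥ 0` are the square roots of the eigenvalues of `XᵀX`. -/
noncomputable def sval (X : Matrix (Fin 3) (Fin 3) ℝ) (i : Fin 3) : ℝ :=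
  Real.sqrt ((isHermitian_tr_mul_self X).eigenvalues
    (Tuple.sort (isHermitian_tr_mul_self X).eigenvalues i.rev))

/-- Column space of a real matrix. -/
noncomputable def colSpace {m n : ℕ} (X : Matrix (Fin m) (Fin n) ℝ) :
    Submodule ℝ (Fin m → ℝ) := LinearMap.range X.mulVecLin

/-- `Y` is the Moore–Penrose pseudoinverse of `X`. -/
def IsMP {m n : ℕ} (X : Matrix (Fin m) (Fin n) ℝ) (Y : Matrix (Fin n) (Fin m) ℝ) : Prop :=
  X * Y * X = X ∧ Y * X * Y = Y ∧ (X * Y)ᵀ = X * Y ∧ (Y * X)ᵀ = Y * X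

/-! ### Pauli operators -/

/-- The operator `∑ k, a k • σ_k`. -/
noncomputable def pauliVec (a : Fin 3 → ℝ) : Matrix (Fin 2) (Fin 2) ℂ :=
  ∑ k : Fin 3, (a k : ℂ) • pauli k

/-- The operator `∑ k l, T k l • (σ_k ⊗ σ_l)`. -/
noncomputable def pauliTensor (T : Matrix (Fin 3) (Fin 3) ℝ) :
    Matrix (Fin 2 × Fin 2) (Fin 2 × Fin 2) ℂ :=
  ∑ k : Fin 3, ∑ l : Fin 3, (T k l : ℂ) • (pauli k ⊗ₖ pauli l)

/-- The two-qubit operator with maximally mixed marginals and correlation matrix `T`. -/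
noncomputable def bellOp (T : Matrix (Fin 3) (Fin 3) ℝ) :
    Matrix (Fin 2 × Fin 2) (Fin 2 × Fin 2) ℂ :=
  (1 / 4 : ℂ) • (1 + pauliTensor T)

/-- The correlation matrix `Tr[ρ (σ_k ⊗ σ_l)]` of a two-qubit operator. -/
noncomputable def corrMat (ρ : Matrix (Fin 2 × Fin 2) (Fin 2 × Fin 2) ℂ) :
    Matrix (Fin 3) (Fin 3) ℝ :=
  Matrix.of fun k l => ((ρ * (pauli k ⊗ₖ pauli l)).trace).re

lemma pauli_zero : pauli 0 = !![0, 1; 1, 0] := by simp [pauli]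

lemma pauli_one : pauli 1 = !![0, -Complex.I; Complex.I, 0] := by simp [pauli]

lemma pauli_two : pauli 2 = !![1, 0; 0, -1] := by simp [pauli]

lemma conjTranspose_pauli (k : Fin 3) : (pauli k)ᴴ = pauli k := by
  fin_cases k <;> ext i j <;> fin_cases i <;> fin_cases j <;>
    simp [pauli_zero, pauli_one, pauli_two]

lemma trace_pauli (k : Fin 3) : (pauli k).trace = 0 := by
  fin_cases k <;> simp [pauli_zero, pauli_one, pauli_two, Matrix.trace_fin_two]

lemma trace_pauli_mul_pauli (k l : Fin 3) :
    (pauli k * pauli l).trace = if k = l then 2 else 0 := by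
  fin_cases k <;> fin_cases l <;>
    simp [pauli_zero, pauli_one, pauli_two, Matrix.trace_fin_two, one_add_one_eq_two]

lemma conjTranspose_pauliVec (a : Fin 3 → ℝ) : (pauliVec a)ᴴ = pauliVec a := by
  simp [pauliVec, Matrix.conjTranspose_sum, conjTranspose_pauli]

lemma conjTranspose_pauliTensor (T : Matrix (Fin 3) (Fin 3) ℝ) :
    (pauliTensor T)ᴴ = pauliTensor T := by
  simp [pauliTensor, Matrix.conjTranspose_sum, conjTranspose_kronecker, conjTranspose_pauli]

lemma pauliVec_mul_self {a : Fin 3 → ℝ} (ha : ∑ k, a k ^ 2 = 1) :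
    pauliVec a * pauliVec a = 1 := by
  have h : (a 0 : ℂ) ^ 2 + (a 1 : ℂ) ^ 2 + (a 2 : ℂ) ^ 2 = 1 := by
    rw [Fin.sum_univ_three] at ha
    exact_mod_cast ha
  ext i j
  fin_cases i <;> fin_cases j <;>
    simp [pauliVec, Fin.sum_univ_three, pauli_zero, pauli_one, pauli_two, Matrix.mul_apply] <;>
    first
      | linear_combination h - (a 1 : ℂ) ^ 2 * Complex.I_sq
      | ring

lemma pauliVec_kronecker (a b : Fin 3 → ℝ) :
    pauliVec a ⊗ₖ pauliVec b = pauliTensor (Matrix.vecMulVec a b) := by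
  ext ⟨i, j⟩ ⟨k, l⟩
  simp only [pauliVec, pauliTensor, Fin.sum_univ_three, kroneckerMap_apply, Matrix.add_apply,
    Matrix.smul_apply, smul_eq_mul, vecMulVec_apply]
  push_cast
  ring

/-- The square of a correlation operator, in terms of the cofactor matrix. -/
lemma pauliTensor_mul_self (T : Matrix (Fin 3) (Fin 3) ℝ) :
    pauliTensor T * pauliTensor T =
      ((∑ k, ∑ l, T k l ^ 2 : ℝ) : ℂ) • (1 : Matrix (Fin 2 × Fin 2) (Fin 2 × Fin 2) ℂ)
        - (2 : ℂ) • pauliTensor (T.adjugateᵀ) := by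
  rw [adjugate_fin_three]
  ext ⟨i, j⟩ ⟨k, l⟩
  fin_cases i <;> fin_cases j <;> fin_cases k <;> fin_cases l <;>
    simp [pauliTensor, Fin.sum_univ_three, pauli_zero, pauli_one, pauli_two, Matrix.mul_apply,
      Fintype.sum_prod_type, kroneckerMap_apply] <;> ring_nf <;>
    simp <;> ring

lemma pauliTensor_add (S T : Matrix (Fin 3) (Fin 3) ℝ) :
    pauliTensor (S + T) = pauliTensor S + pauliTensor T := by
  simp [pauliTensor, add_smul, Finset.sum_add_distrib]

lemma pauliTensor_smul (c : ℝ) (T : Matrix (Fin 3) (Fin 3) ℝ) :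
    pauliTensor (c • T) = (c : ℂ) • pauliTensor T := by
  simp [pauliTensor, mul_smul, Finset.smul_sum]

lemma pauliTensor_neg (T : Matrix (Fin 3) (Fin 3) ℝ) : pauliTensor (-T) = -pauliTensor T := by
  simpa using pauliTensor_smul (-1) T

lemma trace_pauliTensor (T : Matrix (Fin 3) (Fin 3) ℝ) : (pauliTensor T).trace = 0 := by
  simp [pauliTensor, Matrix.trace_sum, trace_kronecker, trace_pauli]

lemma re_trace_mul_pauliTensor (ρ : Matrix (Fin 2 × Fin 2) (Fin 2 × Fin 2) ℂ)
    (T : Matrix (Fin 3) (Fin 3) ℝ) :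
    ((ρ * pauliTensor T).trace).re = ∑ k, ∑ l, T k l * corrMat ρ k l := by
  simp [pauliTensor, corrMat, Finset.mul_sum, Matrix.trace_sum]

lemma corr_eq {m : ℕ} (A B : Matrix (Fin m) (Fin 3) ℝ)
    (ρ : Matrix (Fin 2 × Fin 2) (Fin 2 × Fin 2) ℂ) :
    corr A B ρ = A * corrMat ρ * Bᵀ := by
  ext i j
  have h : corr A B ρ i j = ((ρ * (pauliVec (A i) ⊗ₖ pauliVec (B j))).trace).re := rfl
  rw [h, pauliVec_kronecker, re_trace_mul_pauliTensor]
  simp only [Matrix.mul_apply, Matrix.transpose_apply, vecMulVec_apply, Finset.sum_mul]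
  rw [Finset.sum_comm]
  exact Finset.sum_congr rfl fun _ _ => Finset.sum_congr rfl fun _ _ => by ring

lemma corrMat_bellOp (T : Matrix (Fin 3) (Fin 3) ℝ) : corrMat (bellOp T) = T := by
  ext k l
  simp only [corrMat, bellOp, pauliTensor, Matrix.of_apply, Matrix.smul_mul, Matrix.add_mul,
    Matrix.one_mul, Finset.sum_mul, Matrix.trace_smul, Matrix.trace_add, Matrix.trace_sum,
    ← mul_kronecker_mul, trace_kronecker, trace_pauli, trace_pauli_mul_pauli]
  simp [Finset.sum_ite_eq']
  ring

lemma trace_bellOp (T : Matrix (Fin 3) (Fin 3) ℝ) : (bellOp T).trace = 1 := by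
  simp [bellOp, trace_pauliTensor]

/-! ### Rotations and positivity -/

lemma transpose_mem_specialOrthogonalGroup {R : Matrix (Fin 3) (Fin 3) ℝ}
    (hR : R ∈ specialOrthogonalGroup (Fin 3) ℝ) : Rᵀ ∈ specialOrthogonalGroup (Fin 3) ℝ := by
  rw [mem_specialOrthogonalGroup_iff, mem_orthogonalGroup_iff] at *
  refine ⟨?_, by simpa using hR.2⟩
  simpa [star_eq_conjTranspose] using mul_eq_one_comm.mp hR.1

lemma mul_transpose_of_mem {R : Matrix (Fin 3) (Fin 3) ℝ}
    (hR : R ∈ specialOrthogonalGroup (Fin 3) ℝ) : R * Rᵀ = 1 :=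
  (mem_orthogonalGroup_iff _ _).mp (mem_specialOrthogonalGroup_iff.mp hR).1

lemma transpose_mul_of_mem {R : Matrix (Fin 3) (Fin 3) ℝ}
    (hR : R ∈ specialOrthogonalGroup (Fin 3) ℝ) : Rᵀ * R = 1 :=
  mul_eq_one_comm.mp (mul_transpose_of_mem hR)

lemma adjugate_of_mem {R : Matrix (Fin 3) (Fin 3) ℝ}
    (hR : R ∈ specialOrthogonalGroup (Fin 3) ℝ) : R.adjugate = Rᵀ := by
  calc R.adjugate = R.adjugate * (R * Rᵀ) := by rw [mul_transpose_of_mem hR, mul_one]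
    _ = Rᵀ := by
      rw [← mul_assoc, adjugate_mul, (mem_specialOrthogonalGroup_iff.mp hR).2, one_smul, one_mul]

lemma posSemidef_bellOp_neg {R : Matrix (Fin 3) (Fin 3) ℝ}
    (hR : R ∈ specialOrthogonalGroup (Fin 3) ℝ) : (bellOp (-R)).PosSemidef := by
  have hsum : ∑ k, ∑ l, R k l ^ 2 = 3 := by
    have := congrArg Matrix.trace (mul_transpose_of_mem hR)
    simpa [Matrix.trace, Matrix.mul_apply, ← pow_two] using this
  have hsq := pauliTensor_mul_self R
  rw [hsum, adjugate_of_mem hR, transpose_transpose] at hsq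
  have hherm : (bellOp (-R))ᴴ = bellOp (-R) := by
    simp [bellOp, conjTranspose_pauliTensor]
  have hproj : bellOp (-R) * bellOp (-R) = bellOp (-R) := by
    simp only [bellOp, pauliTensor_neg, smul_mul_smul_comm]
    have : (1 + -pauliTensor R) * (1 + -pauliTensor R)
        = 1 - (2 : ℂ) • pauliTensor R + pauliTensor R * pauliTensor R := by
      rw [two_smul]; noncomm_ring
    rw [this, hsq]
    push_cast
    module
  rw [← hproj]
  nth_rewrite 1 [← hherm]
  exact posSemidef_conjTranspose_mul_self _

lemma diagonal_mem_specialOrthogonalGroup {a b c : ℝ} (ha : a * a = 1) (hb : b * b = 1)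
    (hc : a * b * c = 1) : diagonal ![a, b, c] ∈ specialOrthogonalGroup (Fin 3) ℝ := by
  have hcc : c * c = 1 := by
    linear_combination (-c * c * b * b) * ha - c * c * hb + (a * b * c + 1) * hc
  rw [mem_specialOrthogonalGroup_iff, mem_orthogonalGroup_iff]
  constructor
  · rw [diagonal_transpose,
      diagonal_mul_diagonal, ← diagonal_one]
    congr 1
    ext i
    fin_cases i <;> simp [ha, hb, hcc]
  · simp [det_diagonal, Fin.prod_univ_three, hc]

/-- Positivity of the operator with signed singular values in the Bell tetrahedron. -/
lemma posSemidef_bellOp {U V : Matrix (Fin 3) (Fin 3) ℝ}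
    (hU : U ∈ specialOrthogonalGroup (Fin 3) ℝ) (hV : V ∈ specialOrthogonalGroup (Fin 3) ℝ)
    {a b c : ℝ} (h₀ : a + b + c ≤ 1) (h₁ : a - b - c ≤ 1) (h₂ : -a + b - c ≤ 1)
    (h₃ : -a - b + c ≤ 1) : (bellOp (U * diagonal ![a, b, c] * Vᵀ)).PosSemidef := by
  have hvert : ∀ D ∈ specialOrthogonalGroup (Fin 3) ℝ, (bellOp (-(U * D * Vᵀ))).PosSemidef :=
    fun D hD => posSemidef_bellOp_neg
      (mul_mem (mul_mem hU hD) (transpose_mem_specialOrthogonalGroup hV))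
  have hw : ∀ {p : ℝ} {M : Matrix (Fin 2 × Fin 2) (Fin 2 × Fin 2) ℂ}, p ≤ 1 → M.PosSemidef →
      (((1 - p) / 4 : ℝ) • M).PosSemidef := fun hp hM =>
    hM.smul (by linarith)
  have hdecomp : U * diagonal ![a, b, c] * Vᵀ =
      ((1 - (a + b + c)) / 4) • -(U * diagonal ![1, 1, 1] * Vᵀ) +
      ((1 - (a - b - c)) / 4) • -(U * diagonal ![1, -1, -1] * Vᵀ) +
      ((1 - (-a + b - c)) / 4) • -(U * diagonal ![-1, 1, -1] * Vᵀ) +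
      ((1 - (-a - b + c)) / 4) • -(U * diagonal ![-1, -1, 1] * Vᵀ) := by
    simp only [← Matrix.neg_mul, ← Matrix.smul_mul, ← Matrix.add_mul]
    congr 1
    ext i j
    fin_cases i <;> fin_cases j <;> simp <;> ring
  have key : bellOp (U * diagonal ![a, b, c] * Vᵀ) =
      ((1 - (a + b + c)) / 4) • bellOp (-(U * diagonal ![1, 1, 1] * Vᵀ)) +
      ((1 - (a - b - c)) / 4) • bellOp (-(U * diagonal ![1, -1, -1] * Vᵀ)) +
      ((1 - (-a + b - c)) / 4) • bellOp (-(U * diagonal ![-1, 1, -1] * Vᵀ)) +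
      ((1 - (-a - b + c)) / 4) • bellOp (-(U * diagonal ![-1, -1, 1] * Vᵀ)) := by
    rw [hdecomp]
    simp only [bellOp, pauliTensor_add, pauliTensor_smul, ← Complex.coe_smul]
    push_cast
    module
  rw [key]
  refine (((hw h₀ (hvert _ ?_)).add (hw h₁ (hvert _ ?_))).add (hw h₂ (hvert _ ?_))).add
    (hw h₃ (hvert _ ?_)) <;>
  exact diagonal_mem_specialOrthogonalGroup (by norm_num) (by norm_num) (by norm_num)

/-! ### Constraints on states -/

open scoped MatrixOrder in
lemma re_trace_mul_nonneg {n : Type*} [Fintype n] [DecidableEq n] {P Q : Matrix n n ℂ}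
    (hP : P.PosSemidef) (hQ : Q.PosSemidef) : 0 ≤ ((P * Q).trace).re := by
  obtain ⟨S, rfl⟩ := CStarAlgebra.nonneg_iff_eq_star_mul_self.mp hQ.nonneg
  rw [star_eq_conjTranspose, ← Matrix.mul_assoc, Matrix.trace_mul_comm, ← Matrix.mul_assoc]
  exact (Complex.nonneg_iff.mp (hP.mul_mul_conjTranspose_same S).trace_nonneg).1

lemma Sqm_subset_Smax : Sqm ⊆ Smax := fun _ hρ =>
  ⟨hρ.1.isHermitian, hρ.2, fun _ _ hP hQ => re_trace_mul_nonneg hρ.1 (hP.kronecker hQ)⟩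

lemma trace_transpose_mul_corrMat_le {ρ : Matrix (Fin 2 × Fin 2) (Fin 2 × Fin 2) ℂ}
    (hρ : ρ ∈ Sqm) {R : Matrix (Fin 3) (Fin 3) ℝ} (hR : R ∈ specialOrthogonalGroup (Fin 3) ℝ) :
    (Rᵀ * corrMat ρ).trace ≤ 1 := by
  have h := re_trace_mul_nonneg hρ.1 (posSemidef_bellOp_neg hR)
  have h2 : (Rᵀ * corrMat ρ).trace = ∑ k, ∑ l, R k l * corrMat ρ k l := by
    simp only [Matrix.trace, Matrix.diag, Matrix.mul_apply, transpose_apply]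
    exact Finset.sum_comm
  rw [h2, ← re_trace_mul_pauliTensor]
  simp only [bellOp, pauliTensor_neg, Matrix.mul_smul, Matrix.mul_add, Matrix.mul_one,
    Matrix.mul_neg, Matrix.trace_smul, Matrix.trace_add, Matrix.trace_neg, hρ.2] at h
  norm_num at h
  linarith

lemma posSemidef_one_add_pauliVec {a : Fin 3 → ℝ} (ha : ∑ k, a k ^ 2 = 1) :
    (1 + pauliVec a).PosSemidef := by
  have h : 1 + pauliVec a = (1 / 2 : ℝ) • ((1 + pauliVec a)ᴴ * (1 + pauliVec a)) := by
    rw [conjTranspose_add, conjTranspose_one, conjTranspose_pauliVec]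
    have : (1 + pauliVec a) * (1 + pauliVec a)
        = 1 + (2 : ℝ) • pauliVec a + pauliVec a * pauliVec a := by
      rw [two_smul]; noncomm_ring
    rw [this, pauliVec_mul_self ha]
    module
  rw [h]
  exact (posSemidef_conjTranspose_mul_self _).smul (by norm_num)

lemma pauliVec_neg (a : Fin 3 → ℝ) : pauliVec (-a) = -pauliVec a := by
  simp [pauliVec]

lemma dotProduct_corrMat_mulVec_le {ρ : Matrix (Fin 2 × Fin 2) (Fin 2 × Fin 2) ℂ}
    (hρ : ρ ∈ Smax) {a b : Fin 3 → ℝ} (ha : ∑ k, a k ^ 2 = 1) (hb : ∑ k, b k ^ 2 = 1) :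
    a ⬝ᵥ corrMat ρ *ᵥ b ≤ 1 := by
  have ha' : ∑ k, (-a) k ^ 2 = 1 := by simpa using ha
  have hb' : ∑ k, (-b) k ^ 2 = 1 := by simpa using hb
  have h₁ := hρ.2.2 _ _ (posSemidef_one_add_pauliVec ha) (posSemidef_one_add_pauliVec hb')
  have h₂ := hρ.2.2 _ _ (posSemidef_one_add_pauliVec ha') (posSemidef_one_add_pauliVec hb)
  have hsum : (1 + pauliVec a) ⊗ₖ (1 + pauliVec (-b)) + (1 + pauliVec (-a)) ⊗ₖ (1 + pauliVec b)
      = (2 : ℂ) • (1 - pauliTensor (vecMulVec a b)) := by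
    rw [← pauliVec_kronecker, pauliVec_neg, pauliVec_neg, ← one_kronecker_one]
    ext ⟨i, j⟩ ⟨k, l⟩
    simp only [kroneckerMap_apply, Matrix.add_apply, Matrix.neg_apply, Matrix.smul_apply,
      Matrix.sub_apply, smul_eq_mul]
    ring
  have h₃ := add_nonneg h₁ h₂
  rw [← Complex.add_re, ← Matrix.trace_add, ← Matrix.mul_add, hsum, Matrix.mul_smul,
    Matrix.mul_sub, Matrix.mul_one, Matrix.trace_smul, Matrix.trace_sub, hρ.2.1, smul_eq_mul,
    ← Complex.ofReal_ofNat, Complex.re_ofReal_mul, Complex.sub_re, re_trace_mul_pauliTensor] at h₃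
  have h₄ : a ⬝ᵥ corrMat ρ *ᵥ b = ∑ k, ∑ l, vecMulVec a b k l * corrMat ρ k l := by
    simp only [dotProduct, mulVec, vecMulVec_apply, Finset.mul_sum]
    exact Finset.sum_congr rfl fun _ _ => Finset.sum_congr rfl fun _ _ => by ring
  rw [h₄]
  norm_num at h₃
  linarith

/-! ### Signed singular value decomposition -/

lemma sval_nonneg (X : Matrix (Fin 3) (Fin 3) ℝ) (i : Fin 3) : 0 ≤ sval X i :=
  Real.sqrt_nonneg _

lemma sval_antitone (X : Matrix (Fin 3) (Fin 3) ℝ) : Antitone (sval X) := fun _ _ hij =>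
  Real.sqrt_le_sqrt
    (Tuple.monotone_sort (isHermitian_tr_mul_self X).eigenvalues (Fin.rev_le_rev.mpr hij))

/-- A matrix with orthogonal columns is an orthogonal matrix times a diagonal one. -/
lemma exists_eq_mul_diagonal {n : Type*} [Fintype n] [DecidableEq n] {Y : Matrix n n ℝ}
    {s : n → ℝ} (hY : Yᵀ * Y = diagonal fun i => s i ^ 2) :
    ∃ U ∈ orthogonalGroup n ℝ, Y = U * diagonal s := by
  set v : n → EuclideanSpace ℝ n := fun i => WithLp.toLp 2 ((s i)⁻¹ • Y.col i) with hv
  have hdot : ∀ i j, Y.col i ⬝ᵥ Y.col j = if i = j then s i ^ 2 else 0 := fun i j => by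
    simpa [Matrix.mul_apply, diagonal_apply, dotProduct] using congrFun (congrFun hY i) j
  have hcol : ∀ i, s i = 0 → Y.col i = 0 := fun i hi => by
    rw [← dotProduct_self_eq_zero, hdot]
    simp [hi]
  have hortho : Orthonormal ℝ ({i | s i ≠ 0}.domRestrict v) := by
    rw [orthonormal_iff_ite]
    rintro ⟨i, hi⟩ ⟨j, hj⟩
    have hi' : s i ≠ 0 := hi
    simp only [Set.domRestrict_apply, hv, EuclideanSpace.inner_toLp_toLp, star_trivial,
      smul_dotProduct, dotProduct_smul, hdot, Subtype.mk.injEq, smul_eq_mul]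
    by_cases h : i = j
    · subst h
      simp
      field_simp
    · simp [h, Ne.symm h]
  obtain ⟨b, hb⟩ := hortho.exists_orthonormalBasis_extension_of_card_eq (by simp)
  refine ⟨Matrix.of fun k i => b i k, ?_, ?_⟩
  · rw [mem_orthogonalGroup_iff']
    ext i j
    have := orthonormal_iff_ite.mp b.orthonormal i j
    rw [PiLp.inner_apply] at this
    simpa [Matrix.mul_apply, one_apply, star_eq_conjTranspose, mul_comm] using this
  · ext k i
    rw [mul_diagonal, of_apply]
    by_cases hi : s i = 0
    · simpa [hi] using congrFun (hcol i hi) k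
    · rw [hb i hi]
      simp [hv]
      field_simp

lemma exists_orthogonal_svd (X : Matrix (Fin 3) (Fin 3) ℝ) :
    ∃ U ∈ orthogonalGroup (Fin 3) ℝ, ∃ V ∈ orthogonalGroup (Fin 3) ℝ,
      X = U * diagonal (sval X) * Vᵀ := by
  set hH := isHermitian_tr_mul_self X
  set τ : Equiv.Perm (Fin 3) := Fin.revPerm.trans (Tuple.sort hH.eigenvalues)
  set V : Matrix (Fin 3) (Fin 3) ℝ := Matrix.of fun k i => hH.eigenvectorBasis (τ i) k with hVdef
  have hpsd : (Xᵀ * X).PosSemidef := by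
    simpa [conjTranspose_eq_transpose_of_trivial] using posSemidef_conjTranspose_mul_self X
  have hs : ∀ i, sval X i ^ 2 = hH.eigenvalues (τ i) := fun i =>
    Real.sq_sqrt (hpsd.eigenvalues_nonneg _)
  have hVV : Vᵀ * V = 1 := by
    ext i j
    have := orthonormal_iff_ite.mp hH.eigenvectorBasis.orthonormal (τ i) (τ j)
    rw [PiLp.inner_apply] at this
    simpa [hVdef, Matrix.mul_apply, one_apply, mul_comm] using this
  have hXV : Xᵀ * X * V = V * diagonal fun i => sval X i ^ 2 := by
    ext k i
    have := congrFun (hH.mulVec_eigenvectorBasis (τ i)) k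
    rw [mul_diagonal, hs]
    simpa [hVdef, Matrix.mul_apply, mulVec, dotProduct, mul_comm] using this
  obtain ⟨U, hU, hUX⟩ := exists_eq_mul_diagonal (Y := X * V) (s := sval X) (by
    rw [transpose_mul, Matrix.mul_assoc, ← Matrix.mul_assoc Xᵀ, hXV, ← Matrix.mul_assoc, hVV,
      Matrix.one_mul])
  refine ⟨U, hU, V, ?_, ?_⟩
  · rw [mem_orthogonalGroup_iff']
    exact hVV
  · rw [← hUX, Matrix.mul_assoc, mul_eq_one_comm.mp hVV, Matrix.mul_one]

/-- Negating the last column, if necessary, turns an orthogonal matrix into a rotation. -/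
lemma mul_diagonal_det_mem {U : Matrix (Fin 3) (Fin 3) ℝ} (hU : U ∈ orthogonalGroup (Fin 3) ℝ) :
    U.det * U.det = 1 ∧ U * diagonal ![1, 1, U.det] ∈ specialOrthogonalGroup (Fin 3) ℝ := by
  have hdet : U.det * U.det = 1 := by
    simpa [star_eq_conjTranspose] using congrArg det ((mem_orthogonalGroup_iff _ _).mp hU)
  refine ⟨hdet, mem_specialOrthogonalGroup_iff.mpr ⟨mul_mem hU ?_, ?_⟩⟩
  · rw [mem_orthogonalGroup_iff, diagonal_transpose, diagonal_mul_diagonal, ← diagonal_one]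
    congr 1
    ext i
    fin_cases i <;> simp [hdet]
  · simp [det_diagonal, Fin.prod_univ_three, hdet]

lemma exists_signed_svd (X : Matrix (Fin 3) (Fin 3) ℝ) :
    ∃ U ∈ specialOrthogonalGroup (Fin 3) ℝ, ∃ V ∈ specialOrthogonalGroup (Fin 3) ℝ,
      X = U * diagonal ![sval X 0, sval X 1, Real.sign X.det * sval X 2] * Vᵀ := by
  obtain ⟨U, hU, V, hV, hX⟩ := exists_orthogonal_svd X
  obtain ⟨hu, hU'⟩ := mul_diagonal_det_mem hU
  obtain ⟨hv, hV'⟩ := mul_diagonal_det_mem hV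
  refine ⟨_, hU', _, hV', ?_⟩
  have hdet : X.det = U.det * V.det * (sval X 0 * sval X 1 * sval X 2) := by
    conv_lhs => rw [hX]
    rw [det_mul, det_mul, det_transpose, det_diagonal, Fin.prod_univ_three]
    ring
  have h01 := sval_antitone X (show (0 : Fin 3) ≤ 1 by decide)
  have h12 := sval_antitone X (show (1 : Fin 3) ≤ 2 by decide)
  have h2 := sval_nonneg X 2
  have hsign : Real.sign X.det * sval X 2 = U.det * V.det * sval X 2 := by
    rcases h2.eq_or_lt with h | h
    · simp [← h]
    · have hpos : 0 < sval X 0 * sval X 1 * sval X 2 := by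
        have := h.trans_le h12
        have := this.trans_le h01
        positivity
      congr 1
      have huv : U.det * V.det = 1 ∨ U.det * V.det = -1 :=
        mul_self_eq_one_iff.mp (by linear_combination hu * (V.det * V.det) + hv)
      rcases huv with huv | huv <;> rw [hdet, huv]
      · rw [one_mul, Real.sign_of_pos hpos]
      · rw [neg_one_mul, Real.sign_of_neg (neg_neg_of_pos hpos)]
  rw [hsign, transpose_mul, diagonal_transpose, ← Matrix.mul_assoc,
    Matrix.mul_assoc U, diagonal_mul_diagonal, Matrix.mul_assoc U, diagonal_mul_diagonal]
  nth_rewrite 1 [hX]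
  congr 3
  ext i
  fin_cases i
  · simp
  · simp
  · simp only [Fin.reduceFinMk, cons_val]
    linear_combination (-sval X 2) * (hu * (V.det * V.det) + hv)

/-! ### Matrices of deficient and full rank -/

lemma corr_bellOp {m : ℕ} (A B : Matrix (Fin m) (Fin 3) ℝ) (T : Matrix (Fin 3) (Fin 3) ℝ) :
    corr A B (bellOp T) = A * T * Bᵀ := by
  rw [corr_eq, corrMat_bellOp]

lemma exists_unit_mulVec_eq_zero {m : ℕ} {A : Matrix (Fin m) (Fin 3) ℝ} (hA : A.rank ≤ 2) :
    ∃ n : Fin 3 → ℝ, ∑ k, n k ^ 2 = 1 ∧ A *ᵥ n = 0 := by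
  have hdet : (Aᵀ * A).det = 0 := by
    by_contra h
    have := rank_of_isUnit (Aᵀ * A) ((isUnit_iff_isUnit_det _).mpr (isUnit_iff_ne_zero.mpr h))
    rw [rank_transpose_mul_self, Fintype.card_fin] at this
    omega
  obtain ⟨v, hv, hAv⟩ := exists_mulVec_eq_zero_iff.mpr hdet
  have hAv' : A *ᵥ v = 0 := by
    rw [← conjTranspose_eq_transpose_of_trivial] at hAv
    exact (conjTranspose_mul_self_mulVec_eq_zero A v).mp hAv
  have hpos : 0 < ∑ k, v k ^ 2 := by
    obtain ⟨i, hi⟩ := Function.ne_iff.mp hv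
    exact Finset.sum_pos' (fun _ _ => sq_nonneg _) ⟨i, Finset.mem_univ _, sq_pos_of_ne_zero hi⟩
  refine ⟨(√(∑ k, v k ^ 2))⁻¹ • v, ?_, by rw [mulVec_smul, hAv', smul_zero]⟩
  simp only [Pi.smul_apply, smul_eq_mul, mul_pow, ← Finset.mul_sum, inv_pow, Real.sq_sqrt hpos.le]
  exact inv_mul_cancel₀ hpos.ne'

/-- A matrix bounded by one on unit vectors can be changed along a given direction so that it
becomes the correlation matrix of a quantum state. -/
lemma exists_posSemidef_completion {T : Matrix (Fin 3) (Fin 3) ℝ} {n : Fin 3 → ℝ}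
    (hT : ∀ a b : Fin 3 → ℝ, ∑ k, a k ^ 2 = 1 → ∑ k, b k ^ 2 = 1 → a ⬝ᵥ T *ᵥ b ≤ 1)
    (hn : ∑ k, n k ^ 2 = 1) :
    ∃ v : Fin 3 → ℝ, (bellOp (T + vecMulVec n v)).PosSemidef ∧
      (bellOp (T + vecMulVec n v)ᵀ).PosSemidef := by
  have hnn : n ⬝ᵥ n = 1 := by simpa [dotProduct, pow_two] using hn
  set X := T - vecMulVec n (n ᵥ* T) with hXdef
  have hnX : n ᵥ* X = 0 := by
    rw [hXdef, vecMul_sub, vecMul_vecMulVec, hnn, one_smul, sub_self]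
  have hdet : X.det = 0 := exists_vecMul_eq_zero_iff.mp
    ⟨n, by rintro rfl; simp at hnn, hnX⟩
  obtain ⟨U, hU, V, hV, hX⟩ := exists_signed_svd X
  rw [hdet, Real.sign_zero, zero_mul] at hX
  set s := ![sval X 0, sval X 1, 0] with hs
  have hVV := transpose_mul_of_mem hV
  have hUU := transpose_mul_of_mem hU
  set w := n ᵥ* U with hw
  have hws : ∀ i, w i * s i = 0 := fun i => by
    have h : w ᵥ* diagonal s = 0 := by
      calc w ᵥ* diagonal s = n ᵥ* (U * diagonal s * (Vᵀ * V)) := by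
            rw [hVV, mul_one, hw, vecMul_vecMul]
        _ = n ᵥ* X ᵥ* V := by rw [← Matrix.mul_assoc, ← hX, vecMul_vecMul]
        _ = 0 := by rw [hnX, zero_vecMul]
    simpa [vecMul_diagonal] using congrFun h i
  have hle : ∀ i, s i ≤ 1 := fun i => by
    rcases eq_or_ne (s i) 0 with h0 | h0
    · rw [h0]; exact zero_le_one
    · have hwi : w i = 0 := (mul_eq_zero.mp (hws i)).resolve_right h0
      have hunit : ∀ {R : Matrix (Fin 3) (Fin 3) ℝ}, Rᵀ * R = 1 → ∑ k, R.col i k ^ 2 = 1 :=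
        fun hR => by simpa [Matrix.mul_apply, pow_two] using congrFun (congrFun hR i) i
      have h1 : s i = U.col i ⬝ᵥ X *ᵥ V.col i := by
        have : Uᵀ * X * V = diagonal s := by
          rw [hX, ← Matrix.mul_assoc, ← Matrix.mul_assoc, hUU, Matrix.one_mul, Matrix.mul_assoc,
            hVV, Matrix.mul_one]
        have := congrFun (congrFun this i) i
        rw [diagonal_apply_eq, Matrix.mul_assoc] at this
        exact this.symm
      have h2 : U.col i ⬝ᵥ n = 0 := by
        rw [dotProduct_comm]
        exact hwi
      rw [h1, hXdef, sub_mulVec, dotProduct_sub, vecMulVec_mulVec, dotProduct_smul, h2]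
      simpa using hT _ _ (hunit hUU) (hunit hVV)
  have hww : w 0 ^ 2 + w 1 ^ 2 + w 2 ^ 2 = 1 := by
    have : w ⬝ᵥ w = 1 := by
      rw [hw, ← dotProduct_mulVec, mulVec_vecMul, mul_transpose_of_mem hU, one_mulVec, hnn]
    rw [← this, dotProduct, Fin.sum_univ_three]
    ring
  have hnU : ∀ k, n k = U k 0 * w 0 + U k 1 * w 1 + U k 2 * w 2 := fun k => by
    have : U *ᵥ w = n := by
      rw [hw, mulVec_vecMul, mul_transpose_of_mem hU, one_mulVec]
    rw [← this, mulVec, dotProduct, Fin.sum_univ_three]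
  have h0 : w 0 * sval X 0 = 0 := hws 0
  have h1 : w 1 * sval X 1 = 0 := hws 1
  have hl0 : sval X 0 ≤ 1 := hle 0
  have hl1 : sval X 1 ≤ 1 := hle 1
  have hp0 := sval_nonneg X 0
  have hp1 := sval_nonneg X 1
  set p := sval X 0
  set q := sval X 1
  have key : T + vecMulVec n (-(n ᵥ* T) - (p * q * w 2) • V.col 2) =
      U * diagonal ![p, q, -(p * q)] * Vᵀ := by
    have hcol : vecMulVec n ((p * q * w 2) • V.col 2) = U * diagonal ![0, 0, p * q] * Vᵀ := by
      ext k l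
      simp only [vecMulVec_apply, Pi.smul_apply, col_apply, smul_eq_mul, Matrix.mul_apply,
        Fin.sum_univ_three, transpose_apply, diagonal_apply]
      simp
      rw [hnU k]
      linear_combination
        V l 2 * (U k 0 * q * w 2 * h0 + U k 1 * p * w 2 * h1 + U k 2 * p * q * hww
          - U k 2 * q * w 0 * h0 - U k 2 * p * w 1 * h1)
    rw [vecMulVec_sub, hcol, vecMulVec_neg, ← add_sub_assoc, ← sub_eq_add_neg, ← hXdef, hX,
      ← Matrix.sub_mul, ← Matrix.mul_sub, diagonal_sub]
    congr 3
    ext i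
    fin_cases i <;> simp [hs]
  refine ⟨-(n ᵥ* T) - (p * q * w 2) • V.col 2, ?_⟩
  rw [key]
  have hT' : (U * diagonal ![p, q, -(p * q)] * Vᵀ)ᵀ = V * diagonal ![p, q, -(p * q)] * Uᵀ := by
    simp [Matrix.mul_assoc]
  rw [hT']
  constructor <;> apply posSemidef_bellOp <;> first | assumption | nlinarith

lemma Cmax_subset_Cqm {m : ℕ} {A B : Matrix (Fin m) (Fin 3) ℝ} (h : min A.rank B.rank ≤ 2) :
    Cmax A B ⊆ Cqm A B := by
  rintro _ ⟨ρ, hρ, rfl⟩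
  rcases min_le_iff.mp h with h | h
  · obtain ⟨n, hn, hAn⟩ := exists_unit_mulVec_eq_zero h
    obtain ⟨v, hv, -⟩ := exists_posSemidef_completion
      (fun a b => dotProduct_corrMat_mulVec_le hρ (a := a) (b := b)) hn
    refine ⟨_, ⟨hv, trace_bellOp _⟩, ?_⟩
    rw [corr_bellOp, corr_eq, Matrix.mul_add, mul_vecMulVec, hAn, zero_vecMulVec, add_zero]
  · obtain ⟨n, hn, hBn⟩ := exists_unit_mulVec_eq_zero h
    obtain ⟨v, -, hv⟩ := exists_posSemidef_completion (T := (corrMat ρ)ᵀ) (fun a b ha hb => by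
      rw [mulVec_transpose, dotProduct_comm, ← dotProduct_mulVec]
      exact dotProduct_corrMat_mulVec_le hρ hb ha) hn
    refine ⟨_, ⟨hv, trace_bellOp _⟩, ?_⟩
    rw [corr_bellOp, corr_eq, transpose_add, transpose_transpose, transpose_vecMulVec,
      Matrix.mul_add, Matrix.add_mul, mul_vecMulVec, vecMulVec_mul, vecMul_transpose, hBn,
      vecMulVec_zero, add_zero]

lemma Cqm_eq_Cmax {m : ℕ} {A B : Matrix (Fin m) (Fin 3) ℝ} (h : min A.rank B.rank ≤ 2) :
    Cqm A B = Cmax A B :=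
  (Set.image_mono Sqm_subset_Smax).antisymm (Cmax_subset_Cqm h)

lemma mul_eq_one_of_rank_eq_three {m : ℕ} {A : Matrix (Fin m) (Fin 3) ℝ}
    {Y : Matrix (Fin 3) (Fin m) ℝ} (hA : A.rank = 3) (h : A * Y * A = A) : Y * A = 1 := by
  have hunit : IsUnit (Y * A) := by
    rw [← mulVec_injective_iff_isUnit]
    have hinj : Function.Injective A.mulVecLin := by
      rw [← LinearMap.ker_eq_bot, ← Submodule.finrank_eq_zero]
      have := A.mulVecLin.finrank_range_add_finrank_ker
      rw [Module.finrank_fin_fun] at this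
      have hr : Module.finrank ℝ (LinearMap.range A.mulVecLin) = 3 := hA
      omega
    intro v w hvw
    apply hinj
    have := congrArg (A *ᵥ ·) hvw
    simpa only [mulVec_mulVec, ← Matrix.mul_assoc, h, mulVecLin_apply] using this
  refine hunit.mul_left_cancel ?_
  rw [Matrix.mul_assoc, ← Matrix.mul_assoc A, h, Matrix.mul_one]

lemma exists_eq_mul_of_colSpace_le {m n p : ℕ} {C : Matrix (Fin m) (Fin n) ℝ}
    {A : Matrix (Fin m) (Fin p) ℝ} (h : colSpace C ≤ colSpace A) :
    ∃ X : Matrix (Fin p) (Fin n) ℝ, C = A * X := by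
  have hcol : ∀ j, ∃ x, A *ᵥ x = C.col j := fun j =>
    h ⟨Pi.single j 1, mulVec_single_one C j⟩
  choose x hx using hcol
  refine ⟨Matrix.of fun k j => x j k, ?_⟩
  ext i j
  exact (congrFun (hx j) i).symm

lemma colSpace_mul_le {m n p : ℕ} (A : Matrix (Fin m) (Fin p) ℝ) (X : Matrix (Fin p) (Fin n) ℝ) :
    colSpace (A * X) ≤ colSpace A := by
  rintro _ ⟨v, rfl⟩
  exact ⟨X *ᵥ v, by simp⟩

/-! ### The gauge function -/

lemma gaugeFn_eq_ofReal {m : ℕ} {K : Set (Matrix (Fin m) (Fin m) ℝ)}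
    {C : Matrix (Fin m) (Fin m) ℝ} {g : ℝ} (h : ∀ t, 0 < t → (t⁻¹ • C ∈ K ↔ g ≤ t)) :
    gaugeFn K C = ENNReal.ofReal g := by
  apply le_antisymm
  · refine ENNReal.le_of_forall_pos_le_add fun ε hε _ => ?_
    have hε' : (0 : ℝ) < ε := hε
    have hpos : 0 < max g 0 + ε := by positivity
    calc gaugeFn K C ≤ ENNReal.ofReal (max g 0 + ε) :=
          iInf₂_le _ ⟨hpos, (h _ hpos).mpr (by linarith [le_max_left g 0])⟩
      _ = ENNReal.ofReal g + ε := by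
          rw [ENNReal.ofReal_add (le_max_right _ _) hε'.le, ENNReal.ofReal_coe_nnreal,
            ENNReal.ofReal_max]
          simp
  · exact le_iInf₂ fun t ht => ENNReal.ofReal_le_ofReal ((h t ht.1).mp ht.2)

lemma inv_smul_mem_Cqm_iff {m : ℕ} {A B : Matrix (Fin m) (Fin 3) ℝ}
    {Ap : Matrix (Fin 3) (Fin m) ℝ} {Bp : Matrix (Fin m) (Fin 3) ℝ} {C : Matrix (Fin m) (Fin m) ℝ}
    (hA : Ap * A = 1) (hB : Bᵀ * Bp = 1) (hC : A * (Ap * C * Bp) * Bᵀ = C) {t : ℝ} (ht : 0 < t) :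
    t⁻¹ • C ∈ Cqm A B ↔ sval (Ap * C * Bp) 0 + sval (Ap * C * Bp) 1 +
      Real.sign (Ap * C * Bp).det * sval (Ap * C * Bp) 2 ≤ t := by
  set X := Ap * C * Bp
  obtain ⟨U, hU, V, hV, hX⟩ := exists_signed_svd X
  have h01 := sval_antitone X (show (0 : Fin 3) ≤ 1 by decide)
  have h12 := sval_antitone X (show (1 : Fin 3) ≤ 2 by decide)
  have h2 := sval_nonneg X 2
  have habs : |Real.sign X.det * sval X 2| ≤ sval X 2 := by
    rcases Real.sign_apply_eq X.det with h | h | h <;> rw [h] <;> simp [abs_of_nonneg h2, h2]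
  obtain ⟨hlo, hhi⟩ := abs_le.mp habs
  set p := sval X 0
  set q := sval X 1
  set r := Real.sign X.det * sval X 2
  constructor
  · rintro ⟨ρ, hρ, hρC⟩
    have hT : corrMat ρ = t⁻¹ • X := by
      calc corrMat ρ = Ap * A * corrMat ρ * (Bᵀ * Bp) := by
            rw [hA, hB, Matrix.one_mul, Matrix.mul_one]
        _ = Ap * corr A B ρ * Bp := by rw [corr_eq]; simp only [Matrix.mul_assoc]
        _ = t⁻¹ • X := by rw [hρC, Matrix.mul_smul, Matrix.smul_mul]
    have h := trace_transpose_mul_corrMat_le hρ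
      (mul_mem hU (transpose_mem_specialOrthogonalGroup hV))
    have htr : ((U * Vᵀ)ᵀ * X).trace = p + q + r := by
      rw [hX, transpose_mul, transpose_transpose, Matrix.mul_assoc V, ← Matrix.mul_assoc Uᵀ,
        ← Matrix.mul_assoc Uᵀ, transpose_mul_of_mem hU, Matrix.one_mul, Matrix.trace_mul_comm,
        Matrix.mul_assoc, transpose_mul_of_mem hV, Matrix.mul_one, trace_diagonal,
        Fin.sum_univ_three]
      rfl
    rw [hT, Matrix.mul_smul, trace_smul, htr, smul_eq_mul, inv_mul_le_iff₀ ht, mul_one] at h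
    exact h
  · intro h
    have hdiv : ∀ {x : ℝ}, x ≤ t → t⁻¹ * x ≤ 1 := fun hx => by
      rwa [inv_mul_le_iff₀ ht, mul_one]
    have hX' : t⁻¹ • X = U * diagonal ![t⁻¹ * p, t⁻¹ * q, t⁻¹ * r] * Vᵀ := by
      rw [hX, ← Matrix.smul_mul, ← Matrix.mul_smul, ← diagonal_smul]
      simp
    refine ⟨bellOp (t⁻¹ • X), ⟨?_, trace_bellOp _⟩, ?_⟩
    · rw [hX']
      apply posSemidef_bellOp hU hV
      · linarith [hdiv h]
      · linarith [hdiv (x := p - q - r) (by linarith)]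
      · linarith [hdiv (x := -p + q - r) (by linarith)]
      · linarith [hdiv (x := -p - q + r) (by linarith)]
    · rw [corr_bellOp, Matrix.mul_smul, Matrix.smul_mul, hC]

/-- Gauge function of the quantum correlation set for `m ≥ 3`. -/
theorem stmt8 {m : ℕ} (hm : 3 ≤ m) (A B : Matrix (Fin m) (Fin 3) ℝ)
    (hA : ∀ i, ∑ k, A i k ^ 2 = 1) (hB : ∀ i, ∑ k, B i k ^ 2 = 1)
    (C : Matrix (Fin m) (Fin m) ℝ)
    (Ap : Matrix (Fin 3) (Fin m) ℝ) (Bp : Matrix (Fin m) (Fin 3) ℝ)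
    (hAp : IsMP A Ap) (hBp : IsMP Bᵀ Bp) :
    (min A.rank B.rank = 3 → colSpace C ≤ colSpace A → colSpace Cᵀ ≤ colSpace B →
      gaugeFn (Cqm A B) C =
        ENNReal.ofReal
          (sval (Ap * C * Bp) 0 + sval (Ap * C * Bp) 1 +
            Real.sign (Ap * C * Bp).det * sval (Ap * C * Bp) 2)) ∧
    (min A.rank B.rank = 3 → ¬(colSpace C ≤ colSpace A ∧ colSpace Cᵀ ≤ colSpace B) →
      gaugeFn (Cqm A B) C = ⊤) ∧
    (min A.rank B.rank ≤ 2 → gaugeFn (Cqm A B) C = gaugeFn (Cmax A B) C) := by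
  have hA1 : min A.rank B.rank = 3 → Ap * A = 1 := fun hr =>
    mul_eq_one_of_rank_eq_three
      (le_antisymm (A.rank_le_width) (hr.ge.trans (min_le_left _ _))) hAp.1
  have hB1 : min A.rank B.rank = 3 → Bᵀ * Bp = 1 := fun hr => by
    have h : B * (Bᵀ * Bp)ᵀ = B := by
      simpa [Matrix.mul_assoc] using congrArg transpose hBp.1
    have := mul_eq_one_of_rank_eq_three (Y := Bpᵀ)
      (le_antisymm (B.rank_le_width) (hr.ge.trans (min_le_right _ _)))
      (by simpa [Matrix.mul_assoc] using h)
    simpa using congrArg transpose this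
  refine ⟨fun hr hCA hCB => ?_, fun _ hC => ?_, fun h => by rw [Cqm_eq_Cmax h]⟩
  · obtain ⟨X, hX⟩ := exists_eq_mul_of_colSpace_le hCA
    obtain ⟨Y, hY⟩ := exists_eq_mul_of_colSpace_le hCB
    have hY' : C = Yᵀ * Bᵀ := by rw [← transpose_mul, ← hY, transpose_transpose]
    have hACB : A * (Ap * C * Bp) * Bᵀ = C := by
      calc A * (Ap * C * Bp) * Bᵀ = A * Ap * C * (Bp * Bᵀ) := by simp only [Matrix.mul_assoc]
        _ = C * (Bp * Bᵀ) := by rw [hX, ← Matrix.mul_assoc (A * Ap), hAp.1]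
        _ = C := by rw [hY', Matrix.mul_assoc, ← Matrix.mul_assoc Bᵀ, hBp.1]
    exact gaugeFn_eq_ofReal fun t ht => inv_smul_mem_Cqm_iff (hA1 hr) (hB1 hr) hACB ht
  · refine iInf₂_eq_top.mpr fun t ht => (hC ?_).elim
    obtain ⟨ht, ρ, -, hρ⟩ := ht
    have hCeq : C = A * (t • (corrMat ρ * Bᵀ)) := by
      rw [Matrix.mul_smul, ← Matrix.mul_assoc, ← corr_eq, hρ, smul_inv_smul₀ ht.ne']
    constructor
    · rw [hCeq]
      exact colSpace_mul_le _ _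
    · have hCt : Cᵀ = B * (t • ((corrMat ρ)ᵀ * Aᵀ)) := by
        rw [hCeq]
        simp [Matrix.mul_assoc]
      rw [hCt]
      exact colSpace_mul_le _ _

end BellCorr
end

section
/- The quantum correlation set equals the convex hull of rotated correlations with negative-determinant orthogonal matrices: C_qm = Conv{ A Q Bᵀ : Q ∈ SO⁻(3) }. -/
open Matrix Kronecker
open scoped ENNReal ComplexOrder

namespace BellCorr

/-- The correlation tensor of a two-qubit operator, with entries `Re Tr[ρ (σ_k ⊗ σ_l)]`,
as a real-linear map. -/
noncomputable def corrTensor :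
    Matrix (Fin 2 × Fin 2) (Fin 2 × Fin 2) ℂ →ₗ[ℝ] Matrix (Fin 3) (Fin 3) ℝ where
  toFun ρ := Matrix.of fun k l => ((ρ * (pauli k ⊗ₖ pauli l)).trace).re
  map_add' x y := by ext; simp [add_mul]
  map_smul' c x := by ext; simp

lemma corrTensor_apply (ρ : Matrix (Fin 2 × Fin 2) (Fin 2 × Fin 2) ℂ) (k l : Fin 3) :
    corrTensor ρ k l = ((ρ * (pauli k ⊗ₖ pauli l)).trace).re := rfl

lemma obs_kronecker_obs {m : ℕ} (A B : Matrix (Fin m) (Fin 3) ℝ) (i j : Fin m) :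
    obs A i ⊗ₖ obs B j =
      ∑ l : Fin 3, ∑ k : Fin 3, (A i k * B j l : ℝ) • (pauli k ⊗ₖ pauli l) := by
  ext ⟨a, b⟩ ⟨c, d⟩
  simp only [obs, kroneckerMap_apply, Matrix.sum_apply, Matrix.smul_apply, smul_eq_mul,
    Complex.real_smul, Finset.sum_mul_sum, Complex.ofReal_mul]
  rw [Finset.sum_comm]
  refine Finset.sum_congr rfl fun _ _ => Finset.sum_congr rfl fun _ _ => by ring

lemma corr_eq_mul_corrTensor_mul {m : ℕ} (A B : Matrix (Fin m) (Fin 3) ℝ)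
    (ρ : Matrix (Fin 2 × Fin 2) (Fin 2 × Fin 2) ℂ) :
    corr A B ρ = A * corrTensor ρ * Bᵀ := by
  ext i j
  rw [Matrix.mul_apply]
  simp only [corr, Matrix.of_apply, obs_kronecker_obs, Matrix.mul_sum, Matrix.mul_smul,
    Matrix.trace_sum, Matrix.trace_smul, Complex.re_sum, Complex.smul_re,
    Matrix.mul_apply (M := A), corrTensor_apply, Finset.sum_mul, transpose_apply, smul_eq_mul]
  refine Finset.sum_congr rfl fun _ _ => Finset.sum_congr rfl fun _ _ => by ring

/-- The correlation tensor of the maximally entangled vector whose coordinates in the magic basis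
are the real numbers `a`, scaled by the squared norm of `a`. -/
def magicTensor (a : Fin 4 → ℝ) : Matrix (Fin 3) (Fin 3) ℝ :=
  !![a 0 ^ 2 - a 1 ^ 2 + a 2 ^ 2 - a 3 ^ 2, -2 * (a 0 * a 1 + a 2 * a 3),
      2 * (a 1 * a 2 - a 0 * a 3);
    2 * (a 2 * a 3 - a 0 * a 1), -a 0 ^ 2 + a 1 ^ 2 + a 2 ^ 2 - a 3 ^ 2,
      2 * (a 0 * a 2 + a 1 * a 3);
    2 * (a 0 * a 3 + a 1 * a 2), 2 * (a 0 * a 2 - a 1 * a 3),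
      a 0 ^ 2 + a 1 ^ 2 - a 2 ^ 2 - a 3 ^ 2]

lemma magicTensor_transpose_mul_self (a : Fin 4 → ℝ) :
    (magicTensor a)ᵀ * magicTensor a = (∑ i, a i ^ 2) ^ 2 • (1 : Matrix (Fin 3) (Fin 3) ℝ) := by
  ext i j
  fin_cases i <;> fin_cases j <;>
    simp [magicTensor, Matrix.mul_apply, Fin.sum_univ_three, Fin.sum_univ_four] <;> ring

lemma det_magicTensor (a : Fin 4 → ℝ) : (magicTensor a).det = -(∑ i, a i ^ 2) ^ 3 := by
  simp [magicTensor, det_fin_three, Fin.sum_univ_four]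
  ring

/-- The orthogonal matrices of determinant `-1`. -/
def negOrthogonal : Set (Matrix (Fin 3) (Fin 3) ℝ) := {Q | Qᵀ * Q = 1 ∧ Q.det = -1}

lemma neg_one_mem_negOrthogonal : (-1 : Matrix (Fin 3) (Fin 3) ℝ) ∈ negOrthogonal := by
  constructor
  · simp
  · norm_num [det_neg]

lemma exists_magicTensor_eq_smul (a : Fin 4 → ℝ) :
    ∃ Q ∈ negOrthogonal, magicTensor a = (∑ i, a i ^ 2) • Q := by
  by_cases h : ∑ i, a i ^ 2 = 0
  · refine ⟨-1, neg_one_mem_negOrthogonal, ?_⟩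
    have ha (i) : a i = 0 := by
      simpa using (Finset.sum_eq_zero_iff_of_nonneg fun i _ => sq_nonneg (a i)).1 h i
    rw [h]
    ext i j
    fin_cases i <;> fin_cases j <;> simp [magicTensor, ha]
  · refine ⟨(∑ i, a i ^ 2)⁻¹ • magicTensor a, ⟨?_, ?_⟩, by rw [smul_inv_smul₀ h]⟩
    · rw [transpose_smul, smul_mul_smul_comm, magicTensor_transpose_mul_self, smul_smul]
      rw [show (∑ i, a i ^ 2)⁻¹ * (∑ i, a i ^ 2)⁻¹ * (∑ i, a i ^ 2) ^ 2 = 1 by field_simp,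
        one_smul]
    · rw [det_smul, det_magicTensor, Fintype.card_fin]
      field_simp

/-- Real parts of the coordinates of `√2 • x` in the magic basis. -/
def magicRe (x : Fin 2 × Fin 2 → ℂ) : Fin 4 → ℝ :=
  ![(x (0, 0) + x (1, 1)).re, (x (0, 0) - x (1, 1)).im,
    (x (0, 1) + x (1, 0)).im, (x (0, 1) - x (1, 0)).re]

lemma sum_magicRe_sq_add (x : Fin 2 × Fin 2 → ℂ) :
    ∑ i, magicRe x i ^ 2 + ∑ i, magicRe (-Complex.I • x) i ^ 2 =
      2 * (x ⬝ᵥ star x).re := by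
  simp [magicRe, Fin.sum_univ_four, dotProduct, Fintype.sum_prod_type]
  ring

lemma corrTensor_vecMulVec (x : Fin 2 × Fin 2 → ℂ) :
    corrTensor (vecMulVec x (star x)) =
      (1 / 2 : ℝ) • (magicTensor (magicRe x) + magicTensor (magicRe (-Complex.I • x))) := by
  ext k l
  fin_cases k <;> fin_cases l <;>
    simp [corrTensor_apply, trace, Matrix.mul_apply, vecMulVec_apply, Fintype.sum_prod_type, pauli,
      magicTensor, magicRe] <;> ring

lemma conjTranspose_mul_self_eq_sum_vecMulVec {n : Type*} [Fintype n] (M : Matrix n n ℂ) :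
    Mᴴ * M = ∑ r, vecMulVec (star (M r)) (star (star (M r))) := by
  ext i j
  simp [Matrix.mul_apply, Matrix.sum_apply, vecMulVec_apply]

lemma corrTensor_mem_convexHull {ρ : Matrix (Fin 2 × Fin 2) (Fin 2 × Fin 2) ℂ} (hρ : ρ ∈ Sqm) :
    corrTensor ρ ∈ convexHull ℝ negOrthogonal := by
  open scoped MatrixOrder in
  obtain ⟨M, rfl⟩ := CStarAlgebra.nonneg_iff_eq_star_mul_self.mp hρ.1.nonneg
  have htr := hρ.2
  rw [star_eq_conjTranspose, conjTranspose_mul_self_eq_sum_vecMulVec] at htr ⊢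
  set x : (Fin 2 × Fin 2) → (Fin 2 × Fin 2) → ℂ := fun r => star (M r)
  choose Q hQ hQa using fun p : (Fin 2 × Fin 2) × Bool =>
    exists_magicTensor_eq_smul (magicRe (if p.2 then x p.1 else -Complex.I • x p.1))
  have key : corrTensor (∑ r, vecMulVec (x r) (star (x r))) =
      ∑ p : (Fin 2 × Fin 2) × Bool,
        (1 / 2 * ∑ i, magicRe (if p.2 then x p.1 else -Complex.I • x p.1) i ^ 2) • Q p := by
    simp only [map_sum, corrTensor_vecMulVec, mul_smul, ← hQa]
    simp [Fintype.sum_prod_type]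
  change corrTensor (∑ r, vecMulVec (x r) (star (x r))) ∈ _
  rw [key]
  refine (convex_convexHull ℝ _).sum_mem (fun _ _ => by positivity) ?_
    fun p _ => subset_convexHull ℝ _ (hQ p)
  have hre := congrArg Complex.re htr
  rw [trace_sum, Complex.re_sum] at hre
  simp only [trace_vecMulVec, Complex.one_re] at hre
  rw [Fintype.sum_prod_type]
  refine Eq.trans ?_ hre
  refine Finset.sum_congr rfl fun r _ => ?_
  have := sum_magicRe_sq_add (x r)
  simp only [Fintype.sum_bool, if_true, Bool.false_eq_true, if_false]
  linarith

/-- The Bell-diagonal operator with vanishing marginals and correlation tensor `Q`. -/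
noncomputable def bellState (Q : Matrix (Fin 3) (Fin 3) ℝ) :
    Matrix (Fin 2 × Fin 2) (Fin 2 × Fin 2) ℂ :=
  (1 / 4 : ℂ) • (1 + ∑ k, ∑ l, (Q k l : ℂ) • (pauli k ⊗ₖ pauli l))

lemma corrTensor_bellState (Q : Matrix (Fin 3) (Fin 3) ℝ) : corrTensor (bellState Q) = Q := by
  ext k l
  simp only [corrTensor_apply, bellState, Matrix.smul_mul, add_mul, one_mul, Matrix.sum_mul,
    trace_smul, trace_add, trace_sum, trace_kronecker, ← mul_kronecker_mul, trace_pauli,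
    trace_pauli_mul_pauli]
  simp
  ring

lemma trace_bellState (Q : Matrix (Fin 3) (Fin 3) ℝ) : (bellState Q).trace = 1 := by
  simp [bellState, trace_add, trace_sum, trace_kronecker, trace_pauli]

lemma isHermitian_pauli (k : Fin 3) : (pauli k).IsHermitian := by
  ext i j
  fin_cases k <;> fin_cases i <;> fin_cases j <;> simp [pauli]

lemma isHermitian_bellState (Q : Matrix (Fin 3) (Fin 3) ℝ) : (bellState Q).IsHermitian := by
  simp [IsHermitian, bellState, conjTranspose_sum, conjTranspose_kronecker,
    (isHermitian_pauli _).eq]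

lemma adjugate_eq_neg_transpose {Q : Matrix (Fin 3) (Fin 3) ℝ} (hQ : Q ∈ negOrthogonal) :
    Q.adjugate = -Qᵀ := by
  have h : Q * Qᵀ = 1 := mul_eq_one_comm.1 hQ.1
  calc Q.adjugate = Q.adjugate * (Q * Qᵀ) := by rw [h, mul_one]
    _ = -Qᵀ := by rw [← mul_assoc, adjugate_mul, hQ.2]; simp

set_option maxHeartbeats 2000000 in
lemma bellState_mul_self {Q : Matrix (Fin 3) (Fin 3) ℝ} (hQ : Q ∈ negOrthogonal) :
    bellState Q * bellState Q = bellState Q := by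
  have hadj := adjugate_eq_neg_transpose hQ
  rw [adjugate_fin_three] at hadj
  have htr := congrArg trace hQ.1
  have h00 := congrFun₂ hadj 0 0
  have h01 := congrFun₂ hadj 0 1
  have h02 := congrFun₂ hadj 0 2
  have h10 := congrFun₂ hadj 1 0
  have h11 := congrFun₂ hadj 1 1
  have h12 := congrFun₂ hadj 1 2
  have h20 := congrFun₂ hadj 2 0
  have h21 := congrFun₂ hadj 2 1
  have h22 := congrFun₂ hadj 2 2
  simp [trace, Matrix.mul_apply, Fin.sum_univ_three] at htr h00 h01 h02 h10 h11 h12 h20 h21 h22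
  ext ⟨a, b⟩ ⟨c, d⟩
  fin_cases a <;> fin_cases b <;> fin_cases c <;> fin_cases d <;>
    simp [Matrix.mul_apply, Fintype.sum_prod_type, pauli, bellState, Fin.sum_univ_three, one_apply,
      Complex.ext_iff] <;> constructor <;> linarith

lemma bellState_mem_Sqm {Q : Matrix (Fin 3) (Fin 3) ℝ} (hQ : Q ∈ negOrthogonal) :
    bellState Q ∈ Sqm := by
  refine ⟨?_, trace_bellState Q⟩
  have h := posSemidef_conjTranspose_mul_self (bellState Q)
  rwa [(isHermitian_bellState Q).eq, bellState_mul_self hQ] at h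

lemma convex_Sqm : Convex ℝ Sqm := by
  rintro x ⟨hx, hxt⟩ y ⟨hy, hyt⟩ a b ha hb hab
  refine ⟨(hx.smul ha).add (hy.smul hb), ?_⟩
  rw [trace_add, trace_smul, trace_smul, hxt, hyt, ← add_smul, hab, one_smul]

lemma image_corrTensor_Sqm : corrTensor '' Sqm = convexHull ℝ negOrthogonal := by
  refine Set.Subset.antisymm ?_ (convexHull_min ?_ (convex_Sqm.linear_image _))
  · rintro _ ⟨ρ, hρ, rfl⟩
    exact corrTensor_mem_convexHull hρ
  · exact fun Q hQ => ⟨bellState Q, bellState_mem_Sqm hQ, corrTensor_bellState Q⟩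

/-- Convex hull characterization of the quantum correlation set. -/
theorem stmt10 {m : ℕ} (hm : 1 ≤ m) (A B : Matrix (Fin m) (Fin 3) ℝ)
    (hA : ∀ i, ∑ k, A i k ^ 2 = 1) (hB : ∀ i, ∑ k, B i k ^ 2 = 1) :
    Cqm A B = convexHull ℝ {C : Matrix (Fin m) (Fin m) ℝ |
      ∃ Q : Matrix (Fin 3) (Fin 3) ℝ, Qᵀ * Q = 1 ∧ Q.det = -1 ∧ C = A * Q * Bᵀ} := by
  have hlin : IsLinearMap ℝ fun Q : Matrix (Fin 3) (Fin 3) ℝ => A * Q * Bᵀ :=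
    ⟨fun x y => by simp [Matrix.mul_add, Matrix.add_mul], fun c x => by simp⟩
  have himage : {C : Matrix (Fin m) (Fin m) ℝ |
      ∃ Q : Matrix (Fin 3) (Fin 3) ℝ, Qᵀ * Q = 1 ∧ Q.det = -1 ∧ C = A * Q * Bᵀ} =
      (fun Q => A * Q * Bᵀ) '' negOrthogonal := by
    ext C
    exact ⟨fun ⟨Q, h₁, h₂, h₃⟩ => ⟨Q, ⟨h₁, h₂⟩, h₃.symm⟩,
      fun ⟨Q, ⟨h₁, h₂⟩, h₃⟩ => ⟨Q, h₁, h₂, h₃.symm⟩⟩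
  rw [himage, ← hlin.image_convexHull, ← image_corrTensor_Sqm, Set.image_image, Cqm]
  exact Set.image_congr fun ρ _ => corr_eq_mul_corrTensor_mul A B ρ

end BellCorr
end
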